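/- arXiv:2207.00817 — 12 statements merged into one kernel-verified Lean document; each statement's English description precedes it below -/
import Mathlib

section
/- Let R = ⨁_{s∈S} R_s be an S-graded ring inducing S, and let S be cancellative. Then R is graded von Neumann regular if and only if for every homogeneous element x ∈ R there exists a homogeneous element y ∈ R such that x = xyx. -/
/-- `S` is cancellative: `0 ≠ su = tu` implies `s = t`, and `0 ≠ us = ut` implies `s = t`. -/
def SCancellative (S : Type*) [Mul S] [Zero S] : Prop :=
  (∀ s t u : S, s * u ≠ 0 → s * u = t * u → s = t) ∧
  (∀ s t u : S, u * s ≠ 0 → u * s = u * t → s = t)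

/-- `t` is an (LRI)-inverse of `s`: there are idempotents `e, f` with
`es = sf = s`, `ft = te = t`, `st = e` and `ts = f`. -/
def LRIWitness {S : Type*} [Mul S] (s t : S) : Prop :=
  ∃ e f : S, e * e = e ∧ f * f = f ∧ e * s = s ∧ s * f = s ∧
    f * t = t ∧ t * e = t ∧ s * t = e ∧ t * s = f

/-- `S` satisfies the (LRI) condition. -/
def SLRI (S : Type*) [Mul S] : Prop := ∀ s : S, ∃ t : S, LRIWitness s t

/-- An `S`-graded ring inducing `S`: a family of additive subgroups `comp s` of `R`
forming an internal direct sum, with `comp 0 = 0` and `comp s * comp t ⊆ comp (s*t)`;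
the zero of `S` absorbs multiplication. -/
structure SGradedRing (S R : Type*) [Mul S] [Zero S] [DecidableEq S] [NonUnitalRing R] where
  comp : S → AddSubgroup R
  zero_mul' : ∀ s : S, (0 : S) * s = 0
  mul_zero' : ∀ s : S, s * (0 : S) = 0
  comp_zero : comp (0 : S) = ⊥
  mul_mem' : ∀ {s t : S} {x y : R}, x ∈ comp s → y ∈ comp t → x * y ∈ comp (s * t)
  isInternal : DirectSum.IsInternal comp

variable {S R : Type*} [Mul S] [Zero S] [DecidableEq S] [NonUnitalRing R]

/-- `x` is a homogeneous element. -/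
def SGradedRing.IsHomog (G : SGradedRing S R) (x : R) : Prop := ∃ s : S, x ∈ G.comp s

/-- `R` is graded von Neumann regular: `x ∈ xRx` for every homogeneous `x`. -/
def SGradedRing.GradedVNRegular (G : SGradedRing S R) : Prop :=
  ∀ x : R, G.IsHomog x → ∃ r : R, x = x * r * x

/-- The additive subgroup generated by products `a * b`, `a ∈ A`, `b ∈ B`. -/
def subgroupMul (A B : AddSubgroup R) : AddSubgroup R :=
  AddSubgroup.closure {x : R | ∃ a ∈ A, ∃ b ∈ B, x = a * b}

/-- `R` is nearly epsilon-strongly graded. -/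
def SGradedRing.NearlyEpsilonStrong (G : SGradedRing S R) : Prop :=
  SCancellative S ∧ SLRI S ∧
  ∀ s : S, ∀ x ∈ G.comp s, ∃ t : S, LRIWitness s t ∧
    ∃ ε ∈ subgroupMul (G.comp s) (G.comp t), ∃ ε' ∈ subgroupMul (G.comp t) (G.comp s),
      ε * x = x ∧ x * ε' = x

/-- `R` is epsilon-strongly graded. -/
def SGradedRing.EpsilonStrong (G : SGradedRing S R) : Prop :=
  SCancellative S ∧
  ∃ inv : S → S, (∀ s : S, LRIWitness s (inv s)) ∧
    ∃ ε : S → R, ∀ s : S, ε s ∈ subgroupMul (G.comp s) (G.comp (inv s)) ∧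
      ∀ x ∈ G.comp s, ε s * x = x ∧ x * ε (inv s) = x

/-- `R` is strongly graded. -/
def SGradedRing.StronglyGraded (G : SGradedRing S R) : Prop :=
  ∀ s t : S, subgroupMul (G.comp s) (G.comp t) = G.comp (s * t)

/-- `R` is pseudo-unitary. -/
def SGradedRing.PseudoUnitary (G : SGradedRing S R) : Prop :=
  SCancellative S ∧
  ∃ u : S → R,
    (∀ e : S, e * e = e → u e ∈ G.comp e ∧ ∀ x ∈ G.comp e, u e * x = x ∧ x * u e = x) ∧
    (∀ x : R, G.IsHomog x → ∃ e f : S, e * e = e ∧ f * f = f ∧ u e * x = x ∧ x * u f = x)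

/-- A right ideal `I` is homogeneous if it is generated by its homogeneous elements,
equivalently `I = ⨁ₛ (Rₛ ∩ I)`. -/
def SGradedRing.HomogClosed (G : SGradedRing S R) (I : AddSubgroup R) : Prop :=
  I = AddSubgroup.closure {x : R | x ∈ I ∧ G.IsHomog x}

/-- In a cancellative `S` with absorbing zero, `t` is determined by `s * t * s = s ≠ 0`. -/
theorem SCancellative.eq_of_mul_mul_eq_self {S : Type*} [Mul S] [Zero S] (hc : SCancellative S)
    (hz : ∀ s : S, 0 * s = 0) {s t t' : S} (hs : s ≠ 0) (ht : s * t * s = s)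
    (ht' : s * t' * s = s) : t = t' := by
  have h : s * t = s * t' := hc.1 _ _ s (by rwa [ht]) (ht.trans ht'.symm)
  refine hc.2 _ _ s (fun h0 => hs ?_) h
  rw [← ht, h0, hz]

/-- The degree `s` part of `x * r * x`, for `x` of degree `s`, has the form `x * y * x`
with `y` homogeneous and independent of `x`. -/
theorem SGradedRing.exists_isHomog_decompose_mul_mul (G : SGradedRing S R)
    [DirectSum.Decomposition G.comp] (hc : SCancellative S) {s : S} (hs : s ≠ 0) (r : R) :
    ∃ y : R, G.IsHomog y ∧ ∀ x ∈ G.comp s,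
      (DirectSum.decompose G.comp (x * r * x) s : R) = x * y * x := by
  by_cases h : ∃ t : S, s * t * s = s
  · obtain ⟨t, ht⟩ := h
    refine ⟨DirectSum.decompose G.comp r t, ⟨t, SetLike.coe_mem _⟩, fun x hx => ?_⟩
    induction r using DirectSum.Decomposition.inductionOn G.comp with
    | zero => simp
    | @homogeneous i m =>
      have hm := G.mul_mem' (G.mul_mem' hx m.2) hx
      by_cases hi : i = t
      · subst hi
        rw [ht] at hm
        rw [DirectSum.decompose_of_mem_same _ hm, DirectSum.decompose_of_mem_same _ m.2]
      · rw [DirectSum.decompose_of_mem_ne _ hm fun h' =>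
          hi (hc.eq_of_mul_mul_eq_self G.zero_mul' hs h' ht),
          DirectSum.decompose_of_mem_ne _ m.2 hi, mul_zero, zero_mul]
    | add a b ha hb =>
      simp only [mul_add, add_mul, DirectSum.decompose_add, DirectSum.add_apply,
        AddSubgroup.coe_add, ha, hb]
  · refine ⟨0, ⟨0, zero_mem _⟩, fun x hx => ?_⟩
    rw [mul_zero, zero_mul]
    induction r using DirectSum.Decomposition.inductionOn G.comp with
    | zero => simp
    | @homogeneous i m =>
      exact DirectSum.decompose_of_mem_ne _ (G.mul_mem' (G.mul_mem' hx m.2) hx)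
        fun h' => h ⟨i, h'⟩
    | add a b ha hb =>
      simp only [mul_add, add_mul, DirectSum.decompose_add, DirectSum.add_apply,
        AddSubgroup.coe_add, ha, hb, add_zero]

/-- For a cancellative `S`, `R` is graded von Neumann regular iff for every homogeneous
`x` there is a homogeneous `y` with `x = xyx`. -/
theorem stmt0 (G : SGradedRing S R) (hc : SCancellative S) :
    G.GradedVNRegular ↔
      ∀ x : R, G.IsHomog x → ∃ y : R, G.IsHomog y ∧ x = x * y * x := by
  refine ⟨fun h x hx => ?_, fun h x hx => (h x hx).imp fun _ hy => hy.2⟩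
  let := G.isInternal.chooseDecomposition
  obtain ⟨s, hxs⟩ := hx
  by_cases hs : s = 0
  · subst hs
    rw [G.comp_zero, AddSubgroup.mem_bot] at hxs
    exact ⟨0, ⟨0, zero_mem _⟩, by simp [hxs]⟩
  · obtain ⟨r, hr⟩ := h x ⟨s, hxs⟩
    obtain ⟨y, hy, hxy⟩ := G.exists_isHomog_decompose_mul_mul hc hs r
    refine ⟨y, hy, ?_⟩
    rw [← hxy x hxs, ← hr, DirectSum.decompose_of_mem_same _ hxs]
end

section
/- Let R = ⨁_{s∈S} R_s be an S-graded ring inducing S, and let S be cancellative. If R is graded von Neumann regular, then for every idempotent element e ∈ S the ring R_e is von Neumann regular, i.e., for every x ∈ R_e there exists y ∈ R_e with x = xyx. -/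
variable {S R : Type*} [Mul S] [Zero S] [DecidableEq S] [NonUnitalRing R]

/-- Compressing by a homogeneous `x` of idempotent degree `e ≠ 0` sends every component of degree
other than `e` away from `G.comp e`. -/
theorem SGradedRing.exists_sub_mem_iSup_ne (G : SGradedRing S R) (hc : SCancellative S)
    {e : S} (he : e * e = e) (he0 : e ≠ 0) {x : R} (hx : x ∈ G.comp e) (r : R) :
    ∃ y ∈ G.comp e, x * r * x - x * y * x ∈ ⨆ (t : S) (_ : t ≠ e), G.comp t := by
  obtain ⟨d, rfl⟩ := G.isInternal.surjective r
  induction d using DirectSum.induction_on with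
  | zero => exact ⟨0, zero_mem _, by simp⟩
  | of s r =>
    obtain ⟨r, hr⟩ := r
    rw [DirectSum.coeAddMonoidHom_of]
    by_cases hs : s = e
    · subst hs
      exact ⟨r, hr, by simp⟩
    · refine ⟨0, zero_mem _, ?_⟩
      have hne : e * s * e ≠ e := by
        intro h
        have h1 : e * s = e := hc.1 _ _ e (by rwa [h]) (h.trans he.symm)
        exact hs (hc.2 _ _ e (by rwa [h1]) (h1.trans he.symm))
      have hmem : x * r * x ∈ G.comp (e * s * e) := G.mul_mem' (G.mul_mem' hx hr) hx
      rw [mul_zero, zero_mul, sub_zero]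
      exact (le_iSup₂_of_le (f := fun (t : S) (_ : t ≠ e) ↦ G.comp t) _ hne le_rfl) hmem
  | add a b iha ihb =>
    obtain ⟨y, hy, hya⟩ := iha
    obtain ⟨z, hz, hzb⟩ := ihb
    refine ⟨y + z, add_mem hy hz, ?_⟩
    convert add_mem hya hzb using 1
    rw [map_add]
    noncomm_ring

/-- If `R` is graded von Neumann regular and `S` is cancellative, then each ring
component `R_e` (`e` idempotent) is von Neumann regular. -/
theorem stmt1 (G : SGradedRing S R) (hc : SCancellative S) (hreg : G.GradedVNRegular)
    (e : S) (he : e * e = e) :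
    ∀ x ∈ G.comp e, ∃ y ∈ G.comp e, x = x * y * x := by
  intro x hx
  by_cases he0 : e = 0
  · subst he0
    have hx0 : x = 0 := by simpa [G.comp_zero] using hx
    exact ⟨0, zero_mem _, by simp [hx0]⟩
  obtain ⟨r, hr⟩ := hreg x ⟨e, hx⟩
  obtain ⟨y, hy, hxy⟩ := G.exists_sub_mem_iSup_ne hc he he0 hx r
  refine ⟨y, hy, sub_eq_zero.mp ?_⟩
  rw [← hr] at hxy
  have hmem : x * y * x ∈ G.comp e := by
    have h := G.mul_mem' (G.mul_mem' hx hy) hx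
    rwa [he, he] at h
  exact AddSubgroup.disjoint_def.mp (G.isInternal.addSubgroup_iSupIndep e)
    (sub_mem hx hmem) hxy
end

section
/- Let R = ⨁_{s∈S} R_s be an S-graded ring inducing S with S cancellative, and assume R_s ≠ 0 for every s ∈ S∖{0}. If R is graded von Neumann regular, then S satisfies (LRI): for every s ∈ S there exist s⁻¹ ∈ S and idempotent elements e, f ∈ S such that es = sf = s, fs⁻¹ = s⁻¹e = s⁻¹, ss⁻¹ = e and s⁻¹s = f. -/
variable {S R : Type*} [Mul S] [Zero S] [DecidableEq S] [NonUnitalRing R]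

/-- A nonzero element has at most one degree. -/
theorem SGradedRing.degree_unique (G : SGradedRing S R) {s t : S} {x : R}
    (hs : x ∈ G.comp s) (ht : x ∈ G.comp t) (hx : x ≠ 0) : s = t := by
  let _ := G.isInternal.chooseDecomposition
  exact DirectSum.degree_eq_of_mem_mem G.comp hs ht hx

/-- In a graded von Neumann regular ring over a cancellative `S`, every nonzero homogeneous
element has a homogeneous quasi-inverse. -/
theorem SGradedRing.GradedVNRegular.exists_homogeneous {G : SGradedRing S R}
    (hreg : G.GradedVNRegular) (hc : SCancellative S) {s : S} {x : R}
    (hx : x ∈ G.comp s) (hx0 : x ≠ 0) :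
    ∃ t : S, ∃ r ∈ G.comp t, x * r * x = x := by
  classical
  let _ := G.isInternal.chooseDecomposition
  obtain ⟨r, hr⟩ := hreg x ⟨s, hx⟩
  have hs0 : s ≠ 0 := by
    rintro rfl
    exact hx0 (by simpa [G.comp_zero] using hx)
  let c : S → R := fun t => (DirectSum.decompose G.comp r t : R)
  have hmem (t : S) : x * c t * x ∈ G.comp (s * t * s) :=
    G.mul_mem' (G.mul_mem' hx (DirectSum.decompose G.comp r t).2) hx
  have hsum : x = ∑ t ∈ (DirectSum.decompose G.comp r).support,
      (DirectSum.decompose G.comp (x * c t * x) s : R) := by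
    have h : x = ∑ t ∈ (DirectSum.decompose G.comp r).support, x * c t * x := by
      rw [← Finset.sum_mul, ← Finset.mul_sum, DirectSum.sum_support_decompose]
      exact hr
    have h' := congrArg (fun y => (DirectSum.decompose G.comp y s : R)) h
    simpa [DirectSum.decompose_of_mem_same G.comp hx, DirectSum.decompose_sum,
      DFinsupp.finsetSum_apply] using h'
  obtain ⟨t, ht, hne⟩ := Finset.exists_ne_zero_of_sum_ne_zero (hsum ▸ hx0)
  have hdeg {u : S} (hu : (DirectSum.decompose G.comp (x * c u * x) s : R) ≠ 0) :
      s * u * s = s := by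
    by_contra h
    exact hu (DirectSum.decompose_of_mem_ne G.comp (hmem u) h)
  have hts := hdeg hne
  refine ⟨t, c t, (DirectSum.decompose G.comp r t).2, ?_⟩
  rw [Finset.sum_eq_single_of_mem t ht] at hsum
  · rw [DirectSum.decompose_of_mem_same G.comp (hts ▸ hmem t)] at hsum
    exact hsum.symm
  · intro u _ hut
    by_contra hu
    have hus := hdeg hu
    have hst : s * u = s * t := hc.1 _ _ s (hus.symm ▸ hs0) (hus.trans hts.symm)
    refine hut (hc.2 _ _ s (fun h0 => hs0 ?_) hst)
    rw [← hus, h0, G.zero_mul']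

/-- If `R` is graded von Neumann regular, `S` is cancellative and all components over
`S \ {0}` are nonzero, then `S` satisfies (LRI). -/
theorem stmt2 (G : SGradedRing S R) (hc : SCancellative S)
    (hnz : ∀ s : S, s ≠ 0 → G.comp s ≠ ⊥) (hreg : G.GradedVNRegular) :
    SLRI S := by
  intro s
  by_cases hs0 : s = 0
  · subst hs0
    have h := G.zero_mul' 0
    exact ⟨0, 0, 0, h, h, h, h, h, h, h, h⟩
  obtain ⟨x, hx, hx0⟩ := (G.comp s).bot_or_exists_ne_zero.resolve_left (hnz s hs0)
  obtain ⟨t, r, hr, hxr⟩ := hreg.exists_homogeneous hc hx hx0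
  have hxr' : x * (r * x) = x := by rw [← mul_assoc, hxr]
  have hxr0 : x * r ≠ 0 := fun h => hx0 (by rw [← hxr, h, zero_mul])
  have hrx0 : r * x ≠ 0 := fun h => hx0 (by rw [← hxr', h, mul_zero])
  have hst := G.mul_mem' hx hr
  have hts := G.mul_mem' hr hx
  have hidem : x * r * (x * r) = x * r := by rw [← mul_assoc, hxr]
  have hidem' : r * x * (r * x) = r * x := by rw [mul_assoc, hxr']
  have hst0 : s * t ≠ 0 := fun h => hxr0 (by simpa [h, G.comp_zero] using hst)
  have hrxr0 : r * x * r ≠ 0 := fun h => hrx0 (by rw [← hidem', ← mul_assoc, h, zero_mul])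
  have hft := G.mul_mem' hts hr
  have hte : r * x * r ∈ G.comp (t * (s * t)) := by
    rw [mul_assoc]
    exact G.mul_mem' hr hst
  have hsft : s * (t * s * t) = s * t := by
    have h := G.mul_mem' hx hft
    rw [mul_assoc r, ← mul_assoc x, hidem] at h
    exact G.degree_unique h hst hxr0
  have hft_eq : t * s * t = t := hc.2 _ _ s (hsft.symm ▸ hst0) hsft
  refine ⟨t, s * t, t * s, ?_, ?_, ?_, ?_, hft_eq, ?_, rfl, rfl⟩
  · exact G.degree_unique (by simpa only [hidem] using G.mul_mem' hst hst) hst hxr0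
  · exact G.degree_unique (by simpa only [hidem'] using G.mul_mem' hts hts) hts hrx0
  · have h := G.mul_mem' hst hx
    rw [hxr] at h
    exact G.degree_unique h hx hx0
  · have h := G.mul_mem' hx hts
    rw [hxr'] at h
    exact G.degree_unique h hx hx0
  · exact (G.degree_unique hte hft hrxr0).trans hft_eq
end

section
/- Let R = ⨁_{s∈S} R_s be an S-graded ring inducing S with S cancellative, and assume R_s ≠ 0 for every s ∈ S∖{0}. If R is graded von Neumann regular, then R is nearly epsilon-strongly graded. -/
variable {S R : Type*} [Mul S] [Zero S] [DecidableEq S] [NonUnitalRing R]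

namespace SGradedRing

variable (G : SGradedRing S R)

/-- A nonzero element lies in at most one component. -/
theorem eq_of_mem_mem {s t : S} {x : R} (hx : x ≠ 0) (hs : x ∈ G.comp s)
    (ht : x ∈ G.comp t) : s = t := by
  let _ := G.isInternal.chooseDecomposition
  exact DirectSum.degree_eq_of_mem_mem G.comp hs ht hx

/-- A homogeneous von Neumann regular element has a homogeneous quasi-inverse. -/
theorem exists_homogeneous_quasi_inverse (hc : SCancellative S) {s : S} (hs : s ≠ 0) {x r : R}
    (hx0 : x ≠ 0) (hx : x ∈ G.comp s) (hr : x = x * r * x) :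
    ∃ t : S, (s * t) * s = s ∧ ∃ y ∈ G.comp t, x * y * x = x := by
  let _ := G.isInternal.chooseDecomposition
  have hmem {i : S} {m : R} (hm : m ∈ G.comp i) : x * m * x ∈ G.comp ((s * i) * s) :=
    G.mul_mem' (G.mul_mem' hx hm) hx
  by_cases h : ∃ t : S, (s * t) * s = s
  · obtain ⟨t, ht⟩ := h
    refine ⟨t, ht, DirectSum.decompose G.comp r t, SetLike.coe_mem _, ?_⟩
    have key : ∀ r : R, (DirectSum.decompose G.comp (x * r * x) s : R) =
        x * (DirectSum.decompose G.comp r t : R) * x := by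
      intro r
      induction r using DirectSum.Decomposition.inductionOn G.comp with
      | zero => simp
      | @homogeneous i m =>
        by_cases hi : i = t
        · subst hi
          rw [DirectSum.decompose_of_mem_same G.comp (ht ▸ hmem m.2),
            DirectSum.decompose_of_mem_same G.comp m.2]
        · rw [DirectSum.decompose_of_mem_ne G.comp m.2 hi,
            DirectSum.decompose_of_mem_ne G.comp (hmem m.2), mul_zero, zero_mul]
          intro h
          have hst : s * t ≠ 0 := fun h0 => hs (by rw [← ht, h0, G.zero_mul'])
          have hst' : s * t = s * i := hc.1 _ _ s (by rwa [ht]) (ht.trans h.symm)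
          exact hi (hc.2 _ _ s hst hst').symm
      | add a b ha hb =>
        simp only [mul_add, add_mul, DirectSum.decompose_add, DirectSum.add_apply,
          AddSubgroup.coe_add, ha, hb]
    rw [← key r, ← hr, DirectSum.decompose_of_mem_same G.comp hx]
  · have key : ∀ r : R, (DirectSum.decompose G.comp (x * r * x) s : R) = 0 := by
      intro r
      induction r using DirectSum.Decomposition.inductionOn G.comp with
      | zero => simp
      | @homogeneous i m =>
        exact DirectSum.decompose_of_mem_ne G.comp (hmem m.2) fun hi => h ⟨i, hi⟩
      | add a b ha hb =>
        simp only [mul_add, add_mul, DirectSum.decompose_add, DirectSum.add_apply,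
          AddSubgroup.coe_add, ha, hb, add_zero]
    have hxr := key r
    rw [← hr, DirectSum.decompose_of_mem_same G.comp hx] at hxr
    exact absurd hxr hx0

/-- The degree of a homogeneous quasi-inverse is an (LRI)-inverse. -/
theorem lriWitness_of_quasi_inverse (hc : SCancellative S) {s t : S} {x y : R}
    (hx0 : x ≠ 0) (hx : x ∈ G.comp s) (hy : y ∈ G.comp t) (hst : (s * t) * s = s)
    (hxy : x * y * x = x) : LRIWitness s t := by
  have hxy0 : x * y ≠ 0 := fun h => hx0 (by rw [← hxy, h, zero_mul])
  have hyx0 : y * x ≠ 0 := fun h => hx0 (by rw [← hxy, mul_assoc, h, mul_zero])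
  have hxym : x * y ∈ G.comp (s * t) := G.mul_mem' hx hy
  have hyxm : y * x ∈ G.comp (t * s) := G.mul_mem' hy hx
  have ne_zero_of_mem {u : S} {z : R} (hz : z ≠ 0) (hm : z ∈ G.comp u) : u ≠ 0 := by
    rintro rfl
    rw [G.comp_zero, AddSubgroup.mem_bot] at hm
    exact hz hm
  have hxyxy : x * y * (x * y) = x * y := by rw [← mul_assoc, hxy]
  have hyxyx : y * x * (y * x) = y * x := by rw [mul_assoc, ← mul_assoc x, hxy]
  have hts : s * (t * s) = s := by
    refine G.eq_of_mem_mem hx0 ?_ hx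
    have h := G.mul_mem' hx hyxm
    rwa [← mul_assoc, hxy] at h
  have hft : (t * s) * t = t := by
    have h := G.mul_mem' hx (G.mul_mem' hyxm hy)
    rw [mul_assoc y, ← mul_assoc x y, hxyxy] at h
    have heq := G.eq_of_mem_mem hxy0 h hxym
    exact hc.2 _ _ s (ne_zero_of_mem hxy0 h) heq
  have hte : t * (s * t) = t := by
    have h := G.mul_mem' (G.mul_mem' hy hxym) hx
    rw [mul_assoc y, hxy] at h
    have heq := G.eq_of_mem_mem hyx0 h hyxm
    exact hc.1 _ _ s (ne_zero_of_mem hyx0 h) heq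
  refine ⟨s * t, t * s, ?_, ?_, hst, hts, hft, hte, rfl, rfl⟩
  · exact G.eq_of_mem_mem hxy0 (by simpa only [hxyxy] using G.mul_mem' hxym hxym) hxym
  · exact G.eq_of_mem_mem hyx0 (by simpa only [hyxyx] using G.mul_mem' hyxm hyxm) hyxm

/-- A nonzero homogeneous element of a graded von Neumann regular ring has a homogeneous
quasi-inverse whose degree is an (LRI)-inverse of its degree. -/
theorem GradedVNRegular.exists_lriWitness {G : SGradedRing S R} (hreg : G.GradedVNRegular)
    (hc : SCancellative S) {s : S} {x : R} (hx0 : x ≠ 0) (hx : x ∈ G.comp s) :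
    ∃ t : S, LRIWitness s t ∧ ∃ y ∈ G.comp t, x * y * x = x := by
  have hs : s ≠ 0 := by
    rintro rfl
    rw [G.comp_zero, AddSubgroup.mem_bot] at hx
    exact hx0 hx
  obtain ⟨r, hr⟩ := hreg x ⟨s, hx⟩
  obtain ⟨t, hst, y, hy, hxy⟩ := G.exists_homogeneous_quasi_inverse hc hs hx0 hx hr
  exact ⟨t, G.lriWitness_of_quasi_inverse hc hx0 hx hy hst hxy, y, hy, hxy⟩

end SGradedRing

theorem mul_mem_subgroupMul {A B : AddSubgroup R} {a b : R} (ha : a ∈ A) (hb : b ∈ B) :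
    a * b ∈ subgroupMul A B :=
  AddSubgroup.subset_closure ⟨a, ha, b, hb, rfl⟩

/-- If `R` is graded von Neumann regular, `S` is cancellative and all components over
`S \ {0}` are nonzero, then `R` is nearly epsilon-strongly graded. -/
theorem stmt3 (G : SGradedRing S R) (hc : SCancellative S)
    (hnz : ∀ s : S, s ≠ 0 → G.comp s ≠ ⊥) (hreg : G.GradedVNRegular) :
    G.NearlyEpsilonStrong := by
  have hlri : SLRI S := by
    intro s
    by_cases hs : s = 0
    · subst hs
      have h0 := G.zero_mul' 0
      exact ⟨0, 0, 0, h0, h0, h0, h0, h0, h0, h0, h0⟩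
    · obtain ⟨x, hx, hx0⟩ := (AddSubgroup.ne_bot_iff_exists_ne_zero.mp (hnz s hs)).imp
        fun x hx => And.intro x.2 fun h => hx (Subtype.ext h)
      obtain ⟨t, ht, -⟩ := hreg.exists_lriWitness hc hx0 hx
      exact ⟨t, ht⟩
  refine ⟨hc, hlri, fun s x hx => ?_⟩
  by_cases hx0 : x = 0
  · obtain ⟨t, ht⟩ := hlri s
    exact ⟨t, ht, 0, zero_mem _, 0, zero_mem _, by simp [hx0], by simp [hx0]⟩
  · obtain ⟨t, ht, y, hy, hxy⟩ := hreg.exists_lriWitness hc hx0 hx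
    exact ⟨t, ht, x * y, mul_mem_subgroupMul hx hy, y * x, mul_mem_subgroupMul hy hx, hxy,
      by rw [← mul_assoc, hxy]⟩
end

section
/- Let R be an s-unital ring. Let S = {(i,j) : i, j ∈ {1,2}} ∪ {0} with multiplication (i,j)·(k,l) = (i,l) if j = k and all other products equal to 0. For i, j ∈ {1,2}, let (M₂(R))_{(i,j)} be the additive subgroup of the 2×2 matrix ring M₂(R) consisting of the matrices whose entries vanish outside the (i,j) position, and let (M₂(R))_0 = 0. Then M₂(R) = ⨁_{s∈S}(M₂(R))_s is an S-graded ring inducing S which is strongly graded and nearly epsilon-strongly graded. -/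
variable {S R : Type*} [Mul S] [Zero S] [DecidableEq S] [NonUnitalRing R]

/-- The Brandt-type partial groupoid `{(i,j) : i,j ∈ {1,2}} ∪ {0}` with
`(i,j)·(k,l) = (i,l)` if `j = k`, and all other products `0`. -/
inductive S5 : Type
  | zero : S5
  | pair : Fin 2 → Fin 2 → S5
  deriving DecidableEq

instance : Zero S5 := ⟨S5.zero⟩

instance : Mul S5 :=
  ⟨fun a b =>
    match a, b with
    | S5.pair i j, S5.pair k l => if j = k then S5.pair i l else S5.zero
    | _, _ => S5.zero⟩

/-- The component of `M₂(R)` at `(i,j)`: matrices whose entries vanish outside the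
`(i,j)` position; the component at `0` is trivial. -/
def comp5 (R : Type*) [NonUnitalRing R] : S5 → AddSubgroup (Matrix (Fin 2) (Fin 2) R)
  | S5.zero => ⊥
  | S5.pair i j =>
    { carrier := {m | ∀ k l, ¬(k = i ∧ l = j) → m k l = 0}
      zero_mem' := by intro k l _; rfl
      add_mem' := by
        intro a b ha hb k l h
        show a k l + b k l = 0
        rw [ha k l h, hb k l h, add_zero]
      neg_mem' := by
        intro a ha k l h
        show -a k l = 0
        rw [ha k l h, neg_zero] }

namespace S5

theorem pair_mul_pair_same (i j l : Fin 2) : pair i j * pair j l = pair i l :=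
  if_pos rfl

theorem pair_mul_pair_of_ne (i l : Fin 2) {j k : Fin 2} (h : j ≠ k) :
    pair i j * pair k l = zero :=
  if_neg h

theorem zero_mul (s : S5) : zero * s = zero := rfl

theorem mul_zero (s : S5) : s * zero = zero := by cases s <;> rfl

theorem pair_ne_zero (i j : Fin 2) : pair i j ≠ 0 := S5.noConfusion

theorem sCancellative : SCancellative S5 := by
  constructor
  · rintro (_ | ⟨i, j⟩) (_ | ⟨k, l⟩) (_ | ⟨m, n⟩) h0 h
    case pair.pair.pair =>
      obtain rfl : j = m := by
        by_contra hj
        exact h0 (pair_mul_pair_of_ne i n hj)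
      rw [pair_mul_pair_same] at h
      by_cases hl : l = j
      · subst hl
        rw [pair_mul_pair_same] at h
        injection h with h
        rw [h]
      · rw [pair_mul_pair_of_ne k n hl] at h
        exact absurd h (pair_ne_zero i n)
    all_goals first | rfl | exact absurd rfl h0 | exact absurd h h0
  · rintro (_ | ⟨i, j⟩) (_ | ⟨k, l⟩) (_ | ⟨m, n⟩) h0 h
    case pair.pair.pair =>
      obtain rfl : n = i := by
        by_contra hn
        exact h0 (pair_mul_pair_of_ne m j hn)
      rw [pair_mul_pair_same] at h
      by_cases hk : n = k
      · subst hk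
        rw [pair_mul_pair_same] at h
        injection h with _ h
        rw [h]
      · rw [pair_mul_pair_of_ne m l hk] at h
        exact absurd h (pair_ne_zero m j)
    all_goals first | rfl | exact absurd rfl h0 | exact absurd h h0

theorem lriWitness_zero : LRIWitness zero zero :=
  ⟨zero, zero, rfl, rfl, rfl, rfl, rfl, rfl, rfl, rfl⟩

theorem lriWitness_pair (i j : Fin 2) : LRIWitness (pair i j) (pair j i) :=
  ⟨pair i i, pair j j, by simp only [pair_mul_pair_same, and_self]⟩

theorem sLRI : SLRI S5
  | zero => ⟨zero, lriWitness_zero⟩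
  | pair i j => ⟨pair j i, lriWitness_pair i j⟩

end S5

section comp5

variable (A : Type*) [NonUnitalRing A]

theorem mem_comp5_zero {m : Matrix (Fin 2) (Fin 2) A} : m ∈ comp5 A S5.zero ↔ m = 0 :=
  Iff.rfl

variable {A}

theorem single_mem_comp5 (i j : Fin 2) (a : A) : Matrix.single i j a ∈ comp5 A (S5.pair i j) :=
  fun _ _ h => Matrix.single_apply_of_ne _ _ _ _ _ fun h' => h ⟨h'.1.symm, h'.2.symm⟩

theorem eq_single_of_mem_comp5 {i j : Fin 2} {m : Matrix (Fin 2) (Fin 2) A}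
    (hm : m ∈ comp5 A (S5.pair i j)) : m = Matrix.single i j (m i j) := by
  ext k l
  by_cases h : k = i ∧ l = j
  · obtain ⟨rfl, rfl⟩ := h
    rw [Matrix.single_apply_same]
  · rw [hm k l h, single_mem_comp5 i j (m i j) k l h]

theorem mul_mem_comp5 {s t : S5} {x y : Matrix (Fin 2) (Fin 2) A}
    (hx : x ∈ comp5 A s) (hy : y ∈ comp5 A t) : x * y ∈ comp5 A (s * t) := by
  rcases s with _ | ⟨i, j⟩
  · rw [(mem_comp5_zero A).1 hx, zero_mul]
    exact zero_mem _
  rcases t with _ | ⟨k, l⟩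
  · rw [(mem_comp5_zero A).1 hy, mul_zero]
    exact zero_mem _
  rw [eq_single_of_mem_comp5 hx, eq_single_of_mem_comp5 hy]
  by_cases h : j = k
  · subst h
    rw [Matrix.single_mul_single_same, S5.pair_mul_pair_same]
    exact single_mem_comp5 _ _ _
  · rw [Matrix.single_mul_single_of_ne _ _ _ _ h]
    exact zero_mem _

/-- The `(i, j)` entry of a sum of homogeneous matrices is that of its `(i, j)` component. -/
theorem coeAddMonoidHom_comp5_apply (v : DirectSum S5 fun s => comp5 A s) (i j : Fin 2) :
    DirectSum.coeAddMonoidHom (comp5 A) v i j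
      = (v (S5.pair i j) : Matrix (Fin 2) (Fin 2) A) i j := by
  induction v using DirectSum.induction_on with
  | zero => simp
  | add v w hv hw => simp [hv, hw]
  | of s x =>
    rw [DirectSum.coeAddMonoidHom_of]
    by_cases h : s = S5.pair i j
    · subst h
      rw [DirectSum.of_eq_same]
    · rw [DirectSum.of_eq_of_ne _ _ _ (Ne.symm h)]
      obtain ⟨x, hx⟩ := x
      rcases s with _ | ⟨k, l⟩
      · exact congr_fun₂ ((mem_comp5_zero A).1 hx) i j
      · refine hx i j ?_
        rintro ⟨rfl, rfl⟩
        exact h rfl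

theorem isInternal_comp5 : DirectSum.IsInternal (comp5 A) := by
  constructor
  · refine (injective_iff_map_eq_zero (DirectSum.coeAddMonoidHom (comp5 A))).2 fun v hv => ?_
    refine DFinsupp.ext fun s => Subtype.ext ?_
    rcases s with _ | ⟨i, j⟩
    · exact (mem_comp5_zero A).1 (v S5.zero).2
    · rw [eq_single_of_mem_comp5 (v (S5.pair i j)).2, ← coeAddMonoidHom_comp5_apply, hv]
      exact Matrix.single_zero i j
  · intro m
    refine ⟨∑ i, ∑ j, DirectSum.of (fun s => comp5 A s) (S5.pair i j)
      ⟨Matrix.single i j (m i j), single_mem_comp5 i j (m i j)⟩, ?_⟩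
    conv_rhs => rw [Matrix.matrix_eq_sum_single m]
    simp only [map_sum, DirectSum.coeAddMonoidHom_of]

theorem single_mem_subgroupMul_comp5 (hsu : ∀ x : A, ∃ e e' : A, e * x = x ∧ x * e' = x)
    (i j l : Fin 2) (a : A) :
    Matrix.single i l a ∈ subgroupMul (comp5 A (S5.pair i j)) (comp5 A (S5.pair j l)) := by
  obtain ⟨e, -, he, -⟩ := hsu a
  exact AddSubgroup.subset_closure ⟨_, single_mem_comp5 i j e, _, single_mem_comp5 j l a, by
    rw [Matrix.single_mul_single_same, he]⟩

theorem subgroupMul_comp5 (hsu : ∀ x : A, ∃ e e' : A, e * x = x ∧ x * e' = x) (s t : S5) :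
    subgroupMul (comp5 A s) (comp5 A t) = comp5 A (s * t) := by
  apply le_antisymm
  · refine (AddSubgroup.closure_le _).2 ?_
    rintro _ ⟨a, ha, b, hb, rfl⟩
    exact mul_mem_comp5 ha hb
  rcases s with _ | ⟨i, j⟩
  · exact bot_le
  rcases t with _ | ⟨k, l⟩
  · exact bot_le
  by_cases h : j = k
  · subst h
    rw [S5.pair_mul_pair_same]
    intro m hm
    rw [eq_single_of_mem_comp5 hm]
    exact single_mem_subgroupMul_comp5 hsu i j l _
  · rw [S5.pair_mul_pair_of_ne i l h]
    exact bot_le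

end comp5

/-- If `R` is s-unital, then `M₂(R) = ⨁_{s ∈ S5} (M₂(R))_s` is an `S5`-graded ring
inducing `S5` which is strongly graded and nearly epsilon-strongly graded. -/
theorem stmt5 (R : Type*) [NonUnitalRing R]
    (hsu : ∀ x : R, ∃ e e' : R, e * x = x ∧ x * e' = x) :
    ∃ G : SGradedRing S5 (Matrix (Fin 2) (Fin 2) R),
      G.comp = comp5 R ∧ G.StronglyGraded ∧ G.NearlyEpsilonStrong := by
  refine ⟨⟨comp5 R, S5.zero_mul, S5.mul_zero, rfl, mul_mem_comp5, isInternal_comp5⟩, rfl,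
    subgroupMul_comp5 hsu, S5.sCancellative, S5.sLRI, ?_⟩
  rintro (_ | ⟨i, j⟩) x hx
  · exact ⟨S5.zero, S5.lriWitness_zero, 0, zero_mem _, 0, zero_mem _, by
      rw [(mem_comp5_zero R).1 hx, mul_zero, and_self]⟩
  · obtain ⟨e, e', he, he'⟩ := hsu (x i j)
    refine ⟨S5.pair j i, S5.lriWitness_pair i j,
      Matrix.single i i e, single_mem_subgroupMul_comp5 hsu i j i e,
      Matrix.single j j e', single_mem_subgroupMul_comp5 hsu j i j e', ?_⟩
    rw [eq_single_of_mem_comp5 hx, Matrix.single_mul_single_same, Matrix.single_mul_single_same,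
      he, he']
    exact ⟨rfl, rfl⟩
end

section
/- Let R = ⨁_{s∈S} R_s be an S-graded ring inducing S which is nearly epsilon-strongly graded. Then the following statements are equivalent: (i) R is graded von Neumann regular; (ii) for every homogeneous element x ∈ R there exists a homogeneous idempotent a = a² ∈ R such that xR = aR; (iii) whenever x₁, …, xₙ are nonzero homogeneous elements with xᵢ ∈ R_{sᵢ} and sᵢsᵢ⁻¹ = e for all i, for a single nonzero idempotent e ∈ S (sᵢ⁻¹ as in (LRI)), the right ideal x₁R + ⋯ + xₙR equals aR for some homogeneous idempotent a = a² ∈ R. -/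
variable {S R : Type*} [Mul S] [Zero S] [DecidableEq S] [NonUnitalRing R]

theorem SGradedRing.ne_zero_of_mem (G : SGradedRing S R) {s : S} {x : R} (hx : x ∈ G.comp s)
    (hx0 : x ≠ 0) : s ≠ 0 := by
  rintro rfl
  rw [G.comp_zero, AddSubgroup.mem_bot] at hx
  exact hx0 hx

theorem LRIWitness.mul_ne_zero {S : Type*} [Mul S] [Zero S]
    (h0 : ∀ s : S, 0 * s = 0) {s t : S} (hst : LRIWitness s t) (hs : s ≠ 0) : s * t ≠ 0 := by
  obtain ⟨e, f, -, -, hes, -, -, -, rfl, -⟩ := hst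
  intro he
  rw [he, h0] at hes
  exact hs hes.symm

theorem LRIWitness.eq_of_mul_mul_eq {S : Type*} [Mul S] [Zero S]
    (hS : SCancellative S) (h0 : ∀ s : S, 0 * s = 0) {s t u : S}
    (hst : LRIWitness s t) (hs : s ≠ 0) (hu : s * u * s = s) : u = t := by
  have hne := hst.mul_ne_zero h0 hs
  obtain ⟨e, f, -, -, hes, -, -, -, rfl, -⟩ := hst
  have hsu : s * u = s * t := hS.1 _ _ s (by rwa [hu]) (hu.trans hes.symm)
  exact hS.2 _ _ s (by rwa [hsu]) hsu

/-- In a graded von Neumann regular ring the quasi-inverse of a homogeneous element can be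
chosen homogeneous, of inverse degree. -/
theorem SGradedRing.GradedVNRegular.exists_mem_comp {G : SGradedRing S R}
    (hG : G.GradedVNRegular) (hS : SCancellative S) {s t : S} (hst : LRIWitness s t) {x : R}
    (hx : x ∈ G.comp s) : ∃ y ∈ G.comp t, x = x * y * x := by
  by_cases hx0 : x = 0
  · exact ⟨0, zero_mem _, by simp [hx0]⟩
  have hs := G.ne_zero_of_mem hx hx0
  let _ : DirectSum.Decomposition G.comp := G.isInternal.chooseDecomposition
  have key : ∀ r : R, ∃ y ∈ G.comp t,
      (DirectSum.decompose G.comp (x * r * x) s : R) = x * y * x := by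
    intro r
    induction r using DirectSum.Decomposition.inductionOn G.comp with
    | zero => exact ⟨0, zero_mem _, by simp⟩
    | @homogeneous u m =>
      have hm := G.mul_mem' (G.mul_mem' hx m.2) hx
      by_cases hu : s * u * s = s
      · have hut := hst.eq_of_mul_mul_eq hS G.zero_mul' hs hu
        rw [hu] at hm
        exact ⟨m, hut ▸ m.2, DirectSum.decompose_of_mem_same _ hm⟩
      · exact ⟨0, zero_mem _, by simpa using DirectSum.decompose_of_mem_ne _ hm hu⟩
    | add a b ha hb =>
      obtain ⟨y, hy, hay⟩ := ha
      obtain ⟨z, hz, hbz⟩ := hb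
      refine ⟨y + z, add_mem hy hz, ?_⟩
      rw [mul_add, add_mul, DirectSum.decompose_add, DirectSum.add_apply, AddSubgroup.coe_add,
        hay, hbz, mul_add, add_mul]
  obtain ⟨r, hr⟩ := hG x ⟨s, hx⟩
  obtain ⟨y, hy, hxy⟩ := key r
  rw [← hr, DirectSum.decompose_of_mem_same _ hx] at hxy
  exact ⟨y, hy, hxy⟩

/-- Finitely many homogeneous elements with a common left unit degree `e` generate a right ideal
that is generated by an idempotent of degree `e`. -/
theorem SGradedRing.GradedVNRegular.exists_idempotent {G : SGradedRing S R}
    (hG : G.GradedVNRegular) (hS : SCancellative S) {e : S} (he : e * e = e) :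
    ∀ (n : ℕ) (x : Fin n → R) (s : Fin n → S), (∀ i, x i ∈ G.comp (s i)) →
      (∀ i, ∃ t : S, LRIWitness (s i) t ∧ s i * t = e) →
      ∃ a ∈ G.comp e, a * a = a ∧ (∀ i, a * x i = x i) ∧ ∃ r : Fin n → R, a = ∑ i, x i * r i := by
  intro n
  induction n with
  | zero => exact fun x s _ _ => ⟨0, zero_mem _, by simp, fun i => i.elim0, 0, by simp⟩
  | succ n ih =>
    intro x s hx hs
    obtain ⟨p, hp, hpp, hpx, r, hr⟩ := ih (fun i => x i.succ) (fun i => s i.succ)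
      (fun i => hx _) (fun i => hs _)
    obtain ⟨t, hst, rfl⟩ := hs 0
    have hes : s 0 * t * s 0 = s 0 := by
      obtain ⟨e, f, -, -, hes, -, -, -, rfl, -⟩ := hst
      exact hes
    have hpc : p * (x 0 - p * x 0) = 0 := by rw [mul_sub, ← mul_assoc, hpp, sub_self]
    have hc : x 0 - p * x 0 ∈ G.comp (s 0) :=
      sub_mem (hx 0) (by simpa only [hes] using G.mul_mem' hp (hx 0))
    obtain ⟨y, hy, hcy⟩ := hG.exists_mem_comp hS hst hc
    set c := x 0 - p * x 0 with hc_def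
    have hqp : (p + c * y - c * y * p) * p = p := by
      rw [sub_mul, add_mul, mul_assoc (c * y) p p, hpp, add_sub_cancel_right]
    have hqc : (p + c * y - c * y * p) * c = c := by
      rw [sub_mul, add_mul, mul_assoc (c * y) p c, hpc, ← hcy, mul_zero, zero_add, sub_zero]
    refine ⟨p + c * y - c * y * p, ?_, ?_, ?_, ?_⟩
    · have hcy' := G.mul_mem' hc hy
      exact sub_mem (add_mem hp hcy') (by simpa only [he] using G.mul_mem' hcy' hp)
    · rw [mul_sub, mul_add, hqp, ← mul_assoc _ (c * y) p, ← mul_assoc _ c y, hqc]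
    · have hqpz : ∀ z, (p + c * y - c * y * p) * (p * z) = p * z := fun z => by
        rw [← mul_assoc, hqp]
      refine Fin.cases ?_ fun i => ?_
      · rw [show x 0 = c + p * x 0 by rw [hc_def, sub_add_cancel], mul_add, hqc, hqpz]
      · rw [← hpx i, hqpz]
    · refine ⟨Fin.cons (y - y * p) fun i => r i - r i * (x 0 * (y - y * p)), ?_⟩
      simp only [Fin.sum_univ_succ, Fin.cons_zero, Fin.cons_succ, mul_sub (x _) (r _),
        Finset.sum_sub_distrib, ← mul_assoc (x _) (r _), ← Finset.sum_mul, ← hr]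
      rw [hc_def]
      noncomm_ring

/-- If `x ∈ xR = aR` with `a` idempotent, then `x` is von Neumann regular. -/
theorem exists_eq_mul_mul_of_range_eq {x a z : R} (hx : x * z = x) (ha : a * a = a)
    (h : Set.range (fun r : R => x * r) = Set.range (fun r : R => a * r)) :
    ∃ r : R, x = x * r * x := by
  obtain ⟨u, hu⟩ : x ∈ Set.range (fun r : R => a * r) := h ▸ ⟨z, hx⟩
  obtain ⟨v, hv⟩ : a ∈ Set.range (fun r : R => x * r) := h ▸ ⟨a, ha⟩
  refine ⟨v, ?_⟩
  dsimp only at hu hv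
  rw [hv, ← hu, ← mul_assoc, ha]

/-- Characterization of graded von Neumann regularity for nearly epsilon-strongly
graded rings via principal/finitely generated homogeneous right ideals being generated
by homogeneous idempotents. -/
theorem stmt6 (G : SGradedRing S R) (h : G.NearlyEpsilonStrong) :
    (G.GradedVNRegular ↔
      ∀ x : R, G.IsHomog x → ∃ a : R, G.IsHomog a ∧ a * a = a ∧
        Set.range (fun r : R => x * r) = Set.range (fun r : R => a * r)) ∧
    (G.GradedVNRegular ↔
      ∀ (n : ℕ) (x : Fin n → R) (s : Fin n → S) (e : S), e ≠ 0 → e * e = e →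
        (∀ i, x i ≠ 0 ∧ x i ∈ G.comp (s i)) →
        (∀ i, ∃ t : S, LRIWitness (s i) t ∧ s i * t = e) →
        ∃ a : R, G.IsHomog a ∧ a * a = a ∧
          {y : R | ∃ r : Fin n → R, y = ∑ i, x i * r i} =
            Set.range (fun r : R => a * r)) := by
  obtain ⟨hS, -, hε⟩ := h
  refine ⟨⟨?_, ?_⟩, ?_, ?_⟩
  · rintro hG x ⟨s, hx⟩
    obtain ⟨t, hst, -⟩ := hε s x hx
    obtain ⟨y, hy, hxy⟩ := hG.exists_mem_comp hS hst hx
    refine ⟨x * y, ⟨_, G.mul_mem' hx hy⟩, by rw [← mul_assoc, ← hxy], ?_⟩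
    ext z
    constructor
    · rintro ⟨r, rfl⟩
      exact ⟨x * r, by simp only [← mul_assoc, ← hxy]⟩
    · rintro ⟨r, rfl⟩
      exact ⟨y * r, by simp only [mul_assoc]⟩
  · rintro hR x ⟨s, hx⟩
    obtain ⟨t, -, -, -, z, -, -, hz⟩ := hε s x hx
    obtain ⟨a, -, ha, hxa⟩ := hR x ⟨s, hx⟩
    exact exists_eq_mul_mul_of_range_eq hz ha hxa
  · intro hG n x s e _ he hx hs
    obtain ⟨a, hae, ha, hax, r, hr⟩ := hG.exists_idempotent hS he n x s (fun i => (hx i).2) hs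
    refine ⟨a, ⟨e, hae⟩, ha, ?_⟩
    ext z
    constructor
    · rintro ⟨w, rfl⟩
      exact ⟨∑ i, x i * w i, by simp only [Finset.mul_sum, ← mul_assoc, hax]⟩
    · rintro ⟨w, rfl⟩
      exact ⟨fun i => r i * w, by simp only [← mul_assoc, ← Finset.sum_mul, ← hr]⟩
  · rintro hR x ⟨s, hx⟩
    by_cases hx0 : x = 0
    · exact ⟨0, by simp [hx0]⟩
    obtain ⟨t, hst, -, -, z, -, -, hz⟩ := hε s x hx
    have he : s * t * (s * t) = s * t := by
      obtain ⟨e, f, he, -, -, -, -, -, rfl, -⟩ := hst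
      exact he
    obtain ⟨a, -, ha, hxa⟩ := hR 1 (fun _ => x) (fun _ => s) (s * t)
      (hst.mul_ne_zero G.zero_mul' (G.ne_zero_of_mem hx hx0)) he (fun _ => ⟨hx0, hx⟩)
      (fun _ => ⟨t, hst, rfl⟩)
    refine exists_eq_mul_mul_of_range_eq hz ha (hxa ▸ ?_)
    ext w
    constructor
    · rintro ⟨r, rfl⟩
      exact ⟨fun _ => r, by simp⟩
    · rintro ⟨r, rfl⟩
      exact ⟨r 0, by simp⟩
end

section
/- Let R = ⨁_{s∈S} R_s be an S-graded ring inducing S. If R is graded von Neumann regular, then every homogeneous right ideal I of R is idempotent, that is, I² = I: every element of I is a finite sum of products ab with a, b ∈ I. -/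
variable {S R : Type*} [Mul S] [Zero S] [DecidableEq S] [NonUnitalRing R]

/-- If `R` is graded von Neumann regular, then every homogeneous right ideal `I`
is idempotent: `I² = I`. -/
theorem stmt7 (G : SGradedRing S R) (hreg : G.GradedVNRegular)
    (I : AddSubgroup R) (hri : ∀ a ∈ I, ∀ r : R, a * r ∈ I)
    (hhom : G.HomogClosed I) :
    subgroupMul I I = I := by
  apply le_antisymm
  · refine (AddSubgroup.closure_le _).2 ?_
    rintro _ ⟨a, ha, b, -, rfl⟩
    exact hri a ha b
  · refine hhom.le.trans ((AddSubgroup.closure_le _).2 ?_)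
    rintro x ⟨hx, hxh⟩
    obtain ⟨r, hr⟩ := hreg x hxh
    exact AddSubgroup.subset_closure ⟨x * r, hri x hx r, x, hx, hr⟩
end

section
/- Let R = ⨁_{s∈S} R_s be an S-graded ring inducing S. If R is graded von Neumann regular, then every homogeneous two-sided ideal K of R is graded semiprime: for every homogeneous two-sided ideal I of R and every positive integer n, Iⁿ ⊆ K implies I ⊆ K. -/
variable {S R : Type*} [Mul S] [Zero S] [DecidableEq S] [NonUnitalRing R]

/-- Finite powers of an additive subgroup of `R` under multiplication:
`nthIdealPow I n` is the additive subgroup generated by `n`-fold products of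
elements of `I` (for `n ≥ 1`). -/
def nthIdealPow (I : AddSubgroup R) : ℕ → AddSubgroup R
  | 0 => I
  | 1 => I
  | (n + 2) => subgroupMul (nthIdealPow I (n + 1)) I

/-- If `x ∈ xRx` and `x` lies in an ideal `I`, then `x` lies in every power of `I`. -/
theorem mem_nthIdealPow_of_eq_mul_mul {I : AddSubgroup R} (hI : ∀ a ∈ I, ∀ r : R, r * a ∈ I)
    {x r : R} (hx : x ∈ I) (hr : x = x * r * x) (n : ℕ) : x ∈ nthIdealPow I n := by
  induction n with
  | zero => exact hx
  | succ n ih =>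
    cases n with
    | zero => exact hx
    | succ n =>
      exact AddSubgroup.subset_closure ⟨x, ih, r * x, hI x hx r, hr.trans (mul_assoc x r x)⟩

/-- If `R` is graded von Neumann regular, then every homogeneous two-sided ideal `K`
is graded semiprime: `Iⁿ ⊆ K` implies `I ⊆ K` for homogeneous two-sided ideals `I`. -/
theorem stmt8 (G : SGradedRing S R) (hreg : G.GradedVNRegular)
    (K : AddSubgroup R) (hKr : ∀ a ∈ K, ∀ r : R, a * r ∈ K)
    (hKl : ∀ a ∈ K, ∀ r : R, r * a ∈ K) (hKhom : G.HomogClosed K) :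
    ∀ I : AddSubgroup R, (∀ a ∈ I, ∀ r : R, a * r ∈ I) → (∀ a ∈ I, ∀ r : R, r * a ∈ I) →
      G.HomogClosed I → ∀ n : ℕ, 1 ≤ n → nthIdealPow I n ≤ K → I ≤ K := by
  intro I _ hIl hIhom n _ hn
  rw [hIhom, AddSubgroup.closure_le]
  rintro x ⟨hx, hxhom⟩
  obtain ⟨r, hr⟩ := hreg x hxhom
  exact hn (mem_nthIdealPow_of_eq_mul_mul hIl hx hr n)
end

section
/- Let R = ⨁_{s∈S} R_s be an S-graded ring inducing S which is nearly epsilon-strongly graded. If R is graded von Neumann regular, then the graded Jacobson radical of R is zero: the intersection of all graded maximal modular right ideals of R equals {0}. -/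
variable {S R : Type*} [Mul S] [Zero S] [DecidableEq S] [NonUnitalRing R]

namespace SGradedRing

/-- The projection of `R` onto its homogeneous component of degree `s`. -/
noncomputable def proj (G : SGradedRing S R) (s : S) : R →+ R :=
  ((G.comp s).subtype.comp (DFinsupp.evalAddMonoidHom s)).comp
    (AddEquiv.ofBijective (DirectSum.coeAddMonoidHom G.comp) G.isInternal).symm.toAddMonoidHom

lemma proj_mem (G : SGradedRing S R) (s : S) (x : R) : G.proj s x ∈ G.comp s :=
  SetLike.coe_mem _

lemma proj_coeAddMonoidHom (G : SGradedRing S R) (s : S)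
    (v : DirectSum S fun t => G.comp t) :
    G.proj s (DirectSum.coeAddMonoidHom G.comp v) = v s := by
  have h := (AddEquiv.ofBijective (DirectSum.coeAddMonoidHom G.comp)
    G.isInternal).symm_apply_apply v
  exact congrArg (fun w : DirectSum S fun t => G.comp t => (w s : R)) h

lemma proj_of_mem (G : SGradedRing S R) {s : S} {x : R} (hx : x ∈ G.comp s) :
    G.proj s x = x := by
  have h := G.proj_coeAddMonoidHom s (DirectSum.of (fun t => G.comp t) s ⟨x, hx⟩)
  rwa [DirectSum.coeAddMonoidHom_of, DirectSum.of_eq_same] at h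

lemma proj_of_mem_ne (G : SGradedRing S R) {s t : S} {x : R} (hx : x ∈ G.comp t)
    (hts : t ≠ s) : G.proj s x = 0 := by
  have h := G.proj_coeAddMonoidHom s (DirectSum.of (fun t => G.comp t) t ⟨x, hx⟩)
  rwa [DirectSum.coeAddMonoidHom_of, DirectSum.of_eq_of_ne _ _ _ hts.symm] at h

lemma mem_of_proj_mem (G : SGradedRing S R) {K : AddSubgroup R} {x : R}
    (h : ∀ s, G.proj s x ∈ K) : x ∈ K := by
  classical
  obtain ⟨v, rfl⟩ := G.isInternal.surjective x
  simp only [proj_coeAddMonoidHom] at h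
  rw [← DirectSum.sum_support_of v, map_sum]
  refine sum_mem fun s _ => ?_
  rw [DirectSum.coeAddMonoidHom_of]
  exact h s

lemma eq_of_eqOn_homogeneous (G : SGradedRing S R) {f g : R →+ R}
    (h : ∀ s, ∀ x ∈ G.comp s, f x = g x) (x : R) : f x = g x :=
  G.mem_of_proj_mem (K := f.eqLocus g) fun s => h s _ (G.proj_mem s x)

lemma eq_zero_of_mem_comp_zero (G : SGradedRing S R) {x : R} (hx : x ∈ G.comp 0) : x = 0 := by
  rwa [G.comp_zero, AddSubgroup.mem_bot] at hx

lemma proj_mul_left (G : SGradedRing S R) (hS : SCancellative S) {u s : S} (hus : u * s ≠ 0)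
    {a : R} (ha : a ∈ G.comp u) (y : R) : G.proj (u * s) (a * y) = a * G.proj s y := by
  refine G.eq_of_eqOn_homogeneous (f := (G.proj (u * s)).comp (AddMonoidHom.mulLeft a))
    (g := (AddMonoidHom.mulLeft a).comp (G.proj s)) (fun t z hz => ?_) y
  simp only [AddMonoidHom.comp_apply, AddMonoidHom.coe_mulLeft]
  by_cases hts : t = s
  · subst hts
    rw [G.proj_of_mem hz, G.proj_of_mem (G.mul_mem' ha hz)]
  · rw [G.proj_of_mem_ne hz hts, mul_zero]
    exact G.proj_of_mem_ne (G.mul_mem' ha hz) fun h => hts (hS.2 s t u hus h.symm).symm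

lemma proj_mul_right (G : SGradedRing S R) (hS : SCancellative S) {s u : S} (hsu : s * u ≠ 0)
    {a : R} (ha : a ∈ G.comp u) (y : R) : G.proj (s * u) (y * a) = G.proj s y * a := by
  refine G.eq_of_eqOn_homogeneous (f := (G.proj (s * u)).comp (AddMonoidHom.mulRight a))
    (g := (AddMonoidHom.mulRight a).comp (G.proj s)) (fun t z hz => ?_) y
  simp only [AddMonoidHom.comp_apply, AddMonoidHom.mulRight_apply]
  by_cases hts : t = s
  · subst hts
    rw [G.proj_of_mem hz, G.proj_of_mem (G.mul_mem' hz ha)]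
  · rw [G.proj_of_mem_ne hz hts, zero_mul]
    exact G.proj_of_mem_ne (G.mul_mem' hz ha) fun h => hts (hS.1 s t u hsu h.symm).symm

lemma homogClosed_iff_proj_mem (G : SGradedRing S R) (I : AddSubgroup R) :
    G.HomogClosed I ↔ ∀ x ∈ I, ∀ s, G.proj s x ∈ I := by
  constructor
  · intro hI x hx s
    have hle : AddSubgroup.closure {x : R | x ∈ I ∧ G.IsHomog x} ≤ I.comap (G.proj s) := by
      rw [AddSubgroup.closure_le]
      rintro y ⟨hy, t, hyt⟩
      by_cases hts : t = s
      · subst hts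
        simpa [G.proj_of_mem hyt] using hy
      · simp [G.proj_of_mem_ne hyt hts]
    exact hle (hI ▸ hx)
  · intro h
    refine le_antisymm (fun x hx => ?_) ((AddSubgroup.closure_le _).2 fun x hx => hx.1)
    exact G.mem_of_proj_mem fun s =>
      AddSubgroup.subset_closure ⟨h x hx s, s, G.proj_mem s x⟩

/-- In a graded von Neumann regular ring, a nonzero homogeneous element `x` yields a nonzero
homogeneous idempotent that lies in every homogeneous right ideal containing `x`. -/
lemma exists_homogeneous_idempotent (G : SGradedRing S R) (hS : SCancellative S)
    (hLRI : SLRI S) (hreg : G.GradedVNRegular) {s : S} {x : R} (hx : x ∈ G.comp s)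
    (hx0 : x ≠ 0) :
    ∃ (e : S) (p : R), p ∈ G.comp e ∧ p * p = p ∧ p ≠ 0 ∧
      ∀ I : AddSubgroup R, (∀ a ∈ I, ∀ r : R, a * r ∈ I) → G.HomogClosed I → x ∈ I → p ∈ I := by
  obtain ⟨_, e, _, hee, -, hes, -⟩ := hLRI s
  obtain ⟨r, hr⟩ := hreg x ⟨s, hx⟩
  have hs0 : s ≠ 0 := fun h => hx0 (G.eq_zero_of_mem_comp_zero (h ▸ hx))
  have he0 : e ≠ 0 := fun h => hs0 (by rw [← hes, h, G.zero_mul'])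
  have hpx : G.proj e (x * r) * x = x := by
    rw [← G.proj_mul_right hS (hes.symm ▸ hs0) hx, hes, ← hr, G.proj_of_mem hx]
  refine ⟨e, G.proj e (x * r), G.proj_mem e _, ?_, fun h => ?_, fun I hI hIh hxI => ?_⟩
  · rw [← G.proj_mul_left hS (hee.symm ▸ he0) (G.proj_mem e _), ← mul_assoc, hpx, hee]
  · exact hx0 (by rw [← hpx, h, zero_mul])
  · exact (G.homogClosed_iff_proj_mem I).1 hIh _ (hI x hxI r) e

/-- A nonzero homogeneous idempotent is avoided by some graded maximal modular right ideal. -/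
lemma exists_gradedMaximalModular_notMem (G : SGradedRing S R) (hS : SCancellative S) {e : S}
    {p : R} (hp : p ∈ G.comp e) (hpp : p * p = p) (hp0 : p ≠ 0) :
    ∃ I : AddSubgroup R, ((∀ a ∈ I, ∀ r : R, a * r ∈ I) ∧ G.HomogClosed I ∧
      (∃ u : R, G.IsHomog u ∧ ∀ y : R, G.IsHomog y → u * y - y ∈ I) ∧ I ≠ ⊤ ∧
      (∀ J : AddSubgroup R, (∀ a ∈ J, ∀ r : R, a * r ∈ J) → G.HomogClosed J →
        J ≠ ⊤ → I ≤ J → J = I)) ∧ p ∉ I := by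
  let I₀ : AddSubgroup R := (AddMonoidHom.mulLeft p).ker
  have mem_I₀ {y : R} : y ∈ I₀ ↔ p * y = 0 := Iff.rfl
  have sub_mem_I₀ (y : R) : p * y - y ∈ I₀ := by
    rw [mem_I₀, mul_sub, ← mul_assoc, hpp, sub_self]
  let T : Set (AddSubgroup R) :=
    {J | (∀ a ∈ J, ∀ r : R, a * r ∈ J) ∧ G.HomogClosed J ∧ p ∉ J}
  have hI₀ : I₀ ∈ T := by
    refine ⟨fun a ha r => ?_, (G.homogClosed_iff_proj_mem I₀).2 fun y hy s => ?_, fun h => ?_⟩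
    · rw [mem_I₀] at ha ⊢
      rw [← mul_assoc, ha, zero_mul]
    · rw [mem_I₀] at hy ⊢
      by_cases hes : e * s = 0
      · exact G.eq_zero_of_mem_comp_zero (hes ▸ G.mul_mem' hp (G.proj_mem s y))
      · rw [← G.proj_mul_left hS hes hp, hy, map_zero]
    · exact hp0 (hpp ▸ mem_I₀.1 h)
  obtain ⟨I, hI₀I, hI⟩ := zorn_le_nonempty₀ T (fun c hcT hc J hJ => by
    have mem_sSup {x : R} : x ∈ sSup c ↔ ∃ K ∈ c, x ∈ K :=
      AddSubgroup.mem_sSup_of_directedOn ⟨J, hJ⟩ hc.directedOn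
    refine ⟨sSup c, ⟨fun a ha r => ?_,
      (G.homogClosed_iff_proj_mem _).2 fun a ha s => ?_, fun h => ?_⟩, fun K hK => le_sSup hK⟩
    · obtain ⟨K, hK, haK⟩ := mem_sSup.1 ha
      exact mem_sSup.2 ⟨K, hK, (hcT hK).1 a haK r⟩
    · obtain ⟨K, hK, haK⟩ := mem_sSup.1 ha
      exact mem_sSup.2 ⟨K, hK, (G.homogClosed_iff_proj_mem K).1 (hcT hK).2.1 a haK s⟩
    · obtain ⟨K, hK, hpK⟩ := mem_sSup.1 h
      exact (hcT hK).2.2 hpK) I₀ hI₀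
  refine ⟨I, ⟨hI.prop.1, hI.prop.2.1, ⟨p, ⟨e, hp⟩, fun y _ => hI₀I (sub_mem_I₀ y)⟩,
    fun h => hI.prop.2.2 (h ▸ AddSubgroup.mem_top p), fun J hJ hJh hJtop hIJ => ?_⟩,
    hI.prop.2.2⟩
  refine le_antisymm (hI.le_of_ge ⟨hJ, hJh, fun hpJ => hJtop ?_⟩ hIJ) hIJ
  refine (AddSubgroup.eq_top_iff' J).2 fun y => ?_
  simpa using J.sub_mem (hJ p hpJ y) (hIJ (hI₀I (sub_mem_I₀ y)))

end SGradedRing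

/-- If `R` is nearly epsilon-strongly graded and graded von Neumann regular, then the
graded Jacobson radical (the intersection of all graded maximal modular right ideals)
is zero. -/
theorem stmt9 (G : SGradedRing S R) (hnes : G.NearlyEpsilonStrong)
    (hreg : G.GradedVNRegular) :
    {x : R | ∀ I : AddSubgroup R,
      ((∀ a ∈ I, ∀ r : R, a * r ∈ I) ∧ G.HomogClosed I ∧
        (∃ u : R, G.IsHomog u ∧ ∀ y : R, G.IsHomog y → u * y - y ∈ I) ∧
        I ≠ ⊤ ∧
        (∀ J : AddSubgroup R, (∀ a ∈ J, ∀ r : R, a * r ∈ J) → G.HomogClosed J →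
          J ≠ ⊤ → I ≤ J → J = I)) →
      x ∈ I} = {0} := by
  refine Set.eq_singleton_iff_unique_mem.2 ⟨fun I _ => I.zero_mem, fun x hx => ?_⟩
  refine G.mem_of_proj_mem (K := ⊥) fun s => ?_
  by_contra hxs
  obtain ⟨e, p, hp, hpp, hp0, hpI⟩ :=
    G.exists_homogeneous_idempotent hnes.1 hnes.2.1 hreg (G.proj_mem s x) hxs
  obtain ⟨I, hI, hpnI⟩ := G.exists_gradedMaximalModular_notMem hnes.1 hp hpp hp0
  exact hpnI (hpI I hI.1 hI.2.1 ((G.homogClosed_iff_proj_mem I).1 hI.2.1 x (hx I hI) s))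
end

section
/- Let R = ⨁_{s∈S} R_s be an S-graded ring inducing S which is epsilon-strongly graded. Then R is graded von Neumann regular if and only if the ring R_e is von Neumann regular for every idempotent element e ∈ S. -/
variable {S R : Type*} [Mul S] [Zero S] [DecidableEq S] [NonUnitalRing R]

open DirectSum in
/-- If `x ∈ R_e` with `e` a nonzero idempotent and `x = x r x`, then `r` can be replaced by its
component of degree `e`. -/
theorem SGradedRing.exists_mem_comp_of_eq_mul_mul (G : SGradedRing S R) (hS : SCancellative S)
    {e : S} (he : e * e = e) {x r : R} (hx : x ∈ G.comp e) (hr : x = x * r * x) :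
    ∃ y ∈ G.comp e, x = x * y * x := by
  by_cases he0 : e = 0
  · subst he0
    have hx0 : x = 0 := by simpa [G.comp_zero] using hx
    exact ⟨x, hx, by simp [hx0]⟩
  have key : ∀ v : ⨁ s, G.comp s, ∃ w : ⨁ s, G.comp s,
      DirectSum.coeAddMonoidHom G.comp w =
        x * DirectSum.coeAddMonoidHom G.comp v * x ∧ (w e : R) = x * (v e : R) * x := by
    intro v
    induction v using DirectSum.induction_on with
    | zero => exact ⟨0, by simp, by simp⟩
    | of s a =>
      refine ⟨DirectSum.of (fun s => G.comp s) (e * s * e)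
        ⟨x * a * x, G.mul_mem' (G.mul_mem' hx a.2) hx⟩, by simp, ?_⟩
      by_cases hs : s = e
      · subst hs
        rw [DirectSum.coe_of_apply, DirectSum.coe_of_apply]
        simp [he]
      · have hne : e * s * e ≠ e := by
          intro hc
          have h₁ : e * s = e := hS.1 _ _ e (by rwa [hc]) (by rw [hc, he])
          exact hs (hS.2 _ _ e (by rwa [h₁]) (by rw [h₁, he]))
        rw [DirectSum.coe_of_apply, DirectSum.coe_of_apply]
        simp [hs, hne]
    | add v₁ v₂ h₁ h₂ =>
      obtain ⟨w₁, h₁, h₁'⟩ := h₁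
      obtain ⟨w₂, h₂, h₂'⟩ := h₂
      exact ⟨w₁ + w₂, by simp [h₁, h₂, mul_add, add_mul],
        by simp [h₁', h₂', mul_add, add_mul]⟩
  obtain ⟨v, rfl⟩ := G.isInternal.surjective r
  obtain ⟨w, hw, hwe⟩ := key v
  refine ⟨v e, (v e).2, ?_⟩
  have hwx : w = DirectSum.of (fun s => G.comp s) e ⟨x, hx⟩ :=
    G.isInternal.injective (by rw [hw, ← hr, DirectSum.coeAddMonoidHom_of])
  rw [← hwe, hwx, DirectSum.of_eq_same]

/-- In a cancellative `S`, the (LRI)-inverse of an (LRI)-inverse of `s ≠ 0` is `s`. -/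
theorem LRIWitness.eq_of_symm (G : SGradedRing S R) (hS : SCancellative S) {s t u : S}
    (hs : s ≠ 0) (hst : LRIWitness s t) (htu : LRIWitness t u) : u = s := by
  obtain ⟨e, f, -, -, hes, hsf, hft, -, rfl, rfl⟩ := hst
  obtain ⟨e', f', -, -, het, -, -, -, rfl, -⟩ := htu
  have ht : t ≠ 0 := by
    rintro rfl
    exact hs (by rw [← hes, G.mul_zero', G.zero_mul'])
  have hts : t * s ≠ 0 := fun h => hs (by rw [← hsf, h, G.mul_zero'])
  have h₁ : t * s = t * u := hS.1 _ _ t (by rwa [hft]) (by rw [hft, het])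
  exact (hS.2 _ _ t hts h₁).symm

/-- If `R_{st}` is von Neumann regular, then for `u ∈ R_t R_s` the right ideal `x R_t` of `R_{st}`
contains a left unit for `x u` which still fixes everything fixed by a given `x c`. -/
theorem SGradedRing.exists_left_unit (G : SGradedRing S R) {s t : S} (hst : LRIWitness s t)
    (hreg : ∀ x ∈ G.comp (s * t), ∃ y ∈ G.comp (s * t), x = x * y * x)
    {x : R} (hx : x ∈ G.comp s) {u : R} (hu : u ∈ subgroupMul (G.comp t) (G.comp s)) :
    ∀ c ∈ G.comp t, ∃ d ∈ G.comp t, x * d * (x * u) = x * u ∧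
      ∀ y, x * c * y = y → x * d * y = y := by
  obtain ⟨e, f, -, -, -, -, hft, hte, rfl, rfl⟩ := hst
  induction hu using AddSubgroup.closure_induction with
  | zero => exact fun c hc => ⟨c, hc, by simp, fun _ h => h⟩
  | neg u _ ih =>
    intro c hc
    obtain ⟨d, hd, h₁, h₂⟩ := ih c hc
    exact ⟨d, hd, by rw [mul_neg, mul_neg, h₁], h₂⟩
  | add u v _ _ ihu ihv =>
    intro c hc
    obtain ⟨d, hd, h₁, h₂⟩ := ihu c hc
    obtain ⟨d', hd', h₁', h₂'⟩ := ihv d hd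
    exact ⟨d', hd', by rw [mul_add, mul_add, h₂' _ h₁, h₁'], fun y hy => h₂' y (h₂ y hy)⟩
  | mem u hu =>
    obtain ⟨a, ha, b, hb, rfl⟩ := hu
    intro c hc
    have mul_mem {p q : R} (hp : p ∈ G.comp t) (hq : q ∈ G.comp t) : p * x * q ∈ G.comp t :=
      hft ▸ G.mul_mem' (G.mul_mem' hp hx) hq
    have ha' : a - c * x * a ∈ G.comp t := sub_mem ha (mul_mem hc ha)
    obtain ⟨w, hw, hxw⟩ := hreg _ (G.mul_mem' hx ha')
    have hd : (a - c * x * a) * w ∈ G.comp t := by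
      have := G.mul_mem' ha' hw
      rwa [hte] at this
    generalize hdef : (a - c * x * a) * w = d at hd
    have hfix : x * d * (x * (a - c * x * a)) = x * (a - c * x * a) := by
      rw [← hdef, ← mul_assoc x (a - c * x * a) w]
      exact hxw.symm
    refine ⟨c + d - d * x * c, sub_mem (add_mem hc hd) (mul_mem hd hc), ?_, fun y hy => ?_⟩
    · have : x * (c + d - d * x * c) * (x * (a * b)) =
          (x * c * x * a + x * d * (x * (a - c * x * a))) * b := by noncomm_ring
      rw [this, hfix]
      noncomm_ring
    · have : x * (c + d - d * x * c) * y = x * c * y + x * d * (y - x * c * y) := by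
        noncomm_ring
      rw [this, hy]
      simp

/-- An epsilon-strongly graded ring is graded von Neumann regular iff each ring
component `R_e` (`e` idempotent) is von Neumann regular. -/
theorem stmt11 (G : SGradedRing S R) (h : G.EpsilonStrong) :
    G.GradedVNRegular ↔
      ∀ e : S, e * e = e → ∀ x ∈ G.comp e, ∃ y ∈ G.comp e, x = x * y * x := by
  obtain ⟨hS, inv, hinv, ε, hε⟩ := h
  constructor
  · intro hreg e he x hx
    obtain ⟨r, hr⟩ := hreg x ⟨e, hx⟩
    exact G.exists_mem_comp_of_eq_mul_mul hS he hx hr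
  · rintro hreg x ⟨s, hx⟩
    by_cases hs : s = 0
    · subst hs
      exact ⟨0, by simpa [G.comp_zero] using hx⟩
    have hmem := (hε (inv s)).1
    rw [LRIWitness.eq_of_symm G hS hs (hinv s) (hinv (inv s))] at hmem
    have hidem : s * inv s * (s * inv s) = s * inv s := by
      obtain ⟨e, f, he, -, -, -, -, -, rfl, -⟩ := hinv s
      exact he
    obtain ⟨d, -, hd, -⟩ := G.exists_left_unit (hinv s) (hreg _ hidem) hx hmem 0 (zero_mem _)
    rw [((hε s).2 x hx).2] at hd
    exact ⟨d, hd.symm⟩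
end

section
/- Every strongly graded pseudo-unitary S-graded ring R = ⨁_{s∈S} R_s inducing S, for which S satisfies (LRI), is epsilon-strongly graded. -/
variable {S R : Type*} [Mul S] [Zero S] [DecidableEq S] [NonUnitalRing R]

theorem LRIWitness.symm {S : Type*} [Mul S] {s t : S} (h : LRIWitness s t) :
    LRIWitness t s := by
  obtain ⟨e, f, he, hf, hes, hsf, hft, hte, hst, hts⟩ := h
  exact ⟨f, e, hf, he, hft, hte, hes, hsf, hts, hst⟩

theorem LRIWitness.unique {S : Type*} [Mul S] [Zero S] (hc : SCancellative S)
    (hzero_mul : ∀ s : S, (0 : S) * s = 0) (hmul_zero : ∀ s : S, s * (0 : S) = 0)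
    {s t t' : S} (h : LRIWitness s t) (h' : LRIWitness s t') : t = t' := by
  obtain ⟨e, f, -, -, hes, -, -, hte, hst, -⟩ := h
  obtain ⟨e', f', -, -, hes', -, -, hte', hst', -⟩ := h'
  by_cases hs : s = 0
  · subst hs
    rw [hzero_mul] at hst hst'
    rw [← hst, hmul_zero] at hte
    rw [← hst', hmul_zero] at hte'
    rw [← hte, ← hte']
  · have hee : e = e' := hc.1 e e' s (by rwa [hes]) (by rw [hes, hes'])
    have he : e ≠ 0 := by
      rintro rfl
      exact hs (by rw [← hes, hzero_mul])
    exact hc.2 t t' s (by rwa [hst]) (by rw [hst, hst', hee])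

theorem mul_eq_of_mem_subgroupMul {A B : AddSubgroup R} {u x : R}
    (hu : ∀ a ∈ A, u * a = a) (hx : x ∈ subgroupMul A B) : u * x = x := by
  induction hx using AddSubgroup.closure_induction with
  | mem x hx =>
    obtain ⟨a, ha, b, -, rfl⟩ := hx
    rw [← mul_assoc, hu a ha]
  | zero => exact mul_zero u
  | add x y _ _ hx hy => rw [mul_add, hx, hy]
  | neg x _ hx => rw [mul_neg, hx]

theorem eq_mul_of_mem_subgroupMul {A B : AddSubgroup R} {u x : R}
    (hu : ∀ b ∈ B, b * u = b) (hx : x ∈ subgroupMul A B) : x * u = x := by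
  induction hx using AddSubgroup.closure_induction with
  | mem x hx =>
    obtain ⟨a, -, b, hb, rfl⟩ := hx
    rw [mul_assoc, hu b hb]
  | zero => exact zero_mul u
  | add x y _ _ hx hy => rw [add_mul, hx, hy]
  | neg x _ hx => rw [neg_mul, hx]

/-- Every strongly graded pseudo-unitary `S`-graded ring inducing `S`, for which `S`
satisfies (LRI), is epsilon-strongly graded. -/
theorem stmt13 (G : SGradedRing S R) (hpu : G.PseudoUnitary) (hlri : SLRI S)
    (hst : G.StronglyGraded) :
    G.EpsilonStrong := by
  obtain ⟨hc, u, hu, -⟩ := hpu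
  choose inv hinv using hlri
  have hinv_inv (s : S) : inv (inv s) = s :=
    (hinv (inv s)).unique hc G.zero_mul' G.mul_zero' (hinv s).symm
  refine ⟨hc, inv, hinv, fun s => u (s * inv s), fun s => ?_⟩
  obtain ⟨e, f, he, hf, hes, hsf, -, -, hsi, his⟩ := hinv s
  simp only [hinv_inv, hsi, his]
  refine ⟨by rw [hst, hsi]; exact (hu e he).1, fun x hx => ⟨?_, ?_⟩⟩
  · exact mul_eq_of_mem_subgroupMul (fun a ha => ((hu e he).2 a ha).1)
      (by rwa [hst e s, hes])
  · exact eq_mul_of_mem_subgroupMul (fun b hb => ((hu f hf).2 b hb).2)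
      (by rwa [hst s f, hsf])
end

section
/- Let R = ⨁_{s∈S} R_s be a strongly graded pseudo-unitary S-graded ring inducing S, and assume R_s ≠ 0 for every s ∈ S∖{0}. Then R is graded von Neumann regular if and only if the following two conditions are satisfied: (a) for every nonzero homogeneous element x ∈ R there exists a homogeneous element y ∈ R such that xy is a nonzero homogeneous element whose degree is an idempotent element of S (i.e., xy ≠ 0 and xy ∈ R_e for some idempotent e ∈ S); and (b) the ring R_e is von Neumann regular for every idempotent element e ∈ S. -/
variable {S R : Type*} [Mul S] [Zero S] [DecidableEq S] [NonUnitalRing R]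

namespace SGradedRing

theorem degree_unique_s14 (G : SGradedRing S R) {s t : S} {x : R} (hs : x ∈ G.comp s)
    (ht : x ∈ G.comp t) (hx : x ≠ 0) : s = t := by
  by_contra hne
  have hd := G.isInternal.addSubgroup_iSupIndep.pairwiseDisjoint hne
  exact hx (AddSubgroup.mem_bot.1 (hd.le_bot ⟨hs, ht⟩))

theorem degree_ne_zero (G : SGradedRing S R) {s : S} {x : R} (hs : x ∈ G.comp s)
    (hx : x ≠ 0) : s ≠ 0 := by
  rintro rfl
  rw [G.comp_zero] at hs
  exact hx (AddSubgroup.mem_bot.1 hs)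

theorem exists_proj (G : SGradedRing S R) (s : S) :
    ∃ p : R →+ R, (∀ x ∈ G.comp s, p x = x) ∧ ∀ t, t ≠ s → ∀ x ∈ G.comp t, p x = 0 := by
  let E := AddEquiv.ofBijective (DirectSum.coeAddMonoidHom G.comp) G.isInternal
  have hE : ∀ (t : S) (x : G.comp t), E.symm (x : R) = DirectSum.of (fun t => G.comp t) t x := by
    intro t x
    rw [AddEquiv.symm_apply_eq]
    exact (DirectSum.coeAddMonoidHom_of G.comp t x).symm
  refine ⟨{ toFun := fun r => ((E.symm r) s : R), map_zero' := ?_, map_add' := ?_ }, ?_, ?_⟩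
  · simp
  · intro a b
    simp
  · intro x hx
    change ((E.symm x) s : R) = x
    rw [hE s ⟨x, hx⟩, DirectSum.of_eq_same]
  · intro t hts x hx
    change ((E.symm x) s : R) = 0
    rw [hE t ⟨x, hx⟩, DirectSum.of_eq_of_ne _ _ _ hts.symm]
    rfl

/-- In a cancellative grading, an inner inverse of a homogeneous element can be taken
homogeneous. -/
theorem exists_homog_inner_inverse (G : SGradedRing S R) (hc : SCancellative S) {s : S} {x r : R}
    (hs : x ∈ G.comp s) (hx : x ≠ 0) (hr : x = x * r * x) :
    ∃ t : S, ∃ y ∈ G.comp t, x = x * y * x ∧ s * t * s = s := by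
  obtain ⟨p, hp, hp'⟩ := G.exists_proj s
  have hs0 := G.degree_ne_zero hs hx
  have key : ∀ r : R, ∃ t : S, ∃ y ∈ G.comp t,
      p (x * r * x) = x * y * x ∧ (y = 0 ∨ s * t * s = s) := by
    intro r
    obtain ⟨f, rfl⟩ := G.isInternal.surjective r
    induction f using DirectSum.induction_on with
    | of t y =>
      obtain ⟨y, hy⟩ := y
      rw [DirectSum.coeAddMonoidHom_of]
      by_cases h : s * t * s = s
      · refine ⟨t, y, hy, hp _ ?_, Or.inr h⟩
        rw [← h]
        exact G.mul_mem' (G.mul_mem' (h.symm ▸ hs) hy) hs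
      · refine ⟨t, 0, zero_mem _, ?_, Or.inl rfl⟩
        rw [hp' _ h _ (G.mul_mem' (G.mul_mem' hs hy) hs)]
        simp
    | zero => exact ⟨s, 0, zero_mem _, by simp, Or.inl rfl⟩
    | add a b ha hb =>
      rw [map_add]
      obtain ⟨t, y, hy, hay, h⟩ := ha
      obtain ⟨t', y', hy', hby, h'⟩ := hb
      have hadd : p (x * (DirectSum.coeAddMonoidHom G.comp a + DirectSum.coeAddMonoidHom G.comp b) * x) =
          x * (y + y') * x := by
        rw [mul_add, add_mul, map_add, hay, hby, mul_add, add_mul]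
      rcases h with rfl | h
      · exact ⟨t', y', hy', by simpa using hadd, h'⟩
      rcases h' with rfl | h'
      · exact ⟨t, y, hy, by simpa using hadd, Or.inr h⟩
      have h₁ : s * t = s * t' := hc.1 _ _ s (by rwa [h]) (h.trans h'.symm)
      have h₂ : t = t' := hc.2 _ _ s
        (fun h0 => hs0 (by rw [← h, h0, G.zero_mul'])) h₁
      subst h₂
      exact ⟨t, y + y', add_mem hy hy', hadd, Or.inr h⟩
  obtain ⟨t, y, hy, hxy, h⟩ := key r
  rw [← hr, hp x hs] at hxy
  refine ⟨t, y, hy, hxy, h.resolve_left ?_⟩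
  rintro rfl
  exact hx (by simpa using hxy)

/-- If `R_e` is von Neumann regular, then for `m` in the span of `A * B` with `x * A ⊆ R_e`,
a partial inner inverse `w` of `x` can be enlarged to one that also fixes `x * m`. -/
theorem exists_extend_inner_inverse (G : SGradedRing S R) {e : S} (he : e * e = e)
    (hreg : ∀ z ∈ G.comp e, ∃ y ∈ G.comp e, z = z * y * z) {x : R} {A B : AddSubgroup R}
    (hA : ∀ c ∈ A, x * c ∈ G.comp e) {m : R} (hm : m ∈ subgroupMul A B) :
    ∀ w : R, x * w ∈ G.comp e → ∃ w' : R, x * w' ∈ G.comp e ∧ x * w' * (x * m) = x * m ∧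
      ∀ v : R, x * w * (x * v) = x * v → x * w' * (x * v) = x * v := by
  have hmul : ∀ {a b : R}, a ∈ G.comp e → b ∈ G.comp e → a * b ∈ G.comp e := by
    intro a b ha hb
    have := G.mul_mem' ha hb
    rwa [he] at this
  induction hm using AddSubgroup.closure_induction with
  | mem m hm =>
    obtain ⟨c, hc, d, -, rfl⟩ := hm
    intro w hw
    obtain ⟨z', hz', hz⟩ := hreg (x * c - x * w * (x * c))
      (sub_mem (hA c hc) (hmul hw (hA c hc)))
    have hexp : x * (w + (c - w * (x * c)) * (z' - z' * (x * w))) =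
        x * w + (x * c - x * w * (x * c)) * (z' - z' * (x * w)) := by
      noncomm_ring
    refine ⟨w + (c - w * (x * c)) * (z' - z' * (x * w)), ?_, ?_, ?_⟩
    · rw [hexp]
      exact add_mem hw (hmul (sub_mem (hA c hc) (hmul hw (hA c hc)))
        (sub_mem hz' (hmul hz' hw)))
    · rw [hexp]
      have h : (x * w + (x * c - x * w * (x * c)) * (z' - z' * (x * w))) * (x * c) = x * c := by
        calc _ = x * w * (x * c) +
              (x * c - x * w * (x * c)) * z' * (x * c - x * w * (x * c)) := by
              noncomm_ring
          _ = x * c := by rw [← hz]; abel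
      rw [← mul_assoc x c d, ← mul_assoc, h]
    · intro v hv
      rw [hexp]
      calc _ = x * w * (x * v) +
            (x * c - x * w * (x * c)) * z' * (x * v - x * w * (x * v)) := by
            noncomm_ring
        _ = x * v := by rw [hv]; simp
  | zero => exact fun w hw => ⟨w, hw, by simp, fun _ h => h⟩
  | add a b _ _ ha hb =>
    intro w hw
    obtain ⟨w₁, hw₁, hfix₁, hext₁⟩ := ha w hw
    obtain ⟨w₂, hw₂, hfix₂, hext₂⟩ := hb w₁ hw₁
    refine ⟨w₂, hw₂, ?_, fun v hv => hext₂ v (hext₁ v hv)⟩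
    rw [mul_add, mul_add, hext₂ a hfix₁, hfix₂]
  | neg a _ ha =>
    intro w hw
    obtain ⟨w₁, hw₁, hfix₁, hext₁⟩ := ha w hw
    exact ⟨w₁, hw₁, by rw [mul_neg, mul_neg, hfix₁], hext₁⟩

theorem exists_mul_ne_zero_of_mem_subgroupMul {A B : AddSubgroup R} {m x : R}
    (hm : m ∈ subgroupMul A B) (hx : m * x ≠ 0) : ∃ a ∈ A, ∃ b ∈ B, a * b * x ≠ 0 := by
  by_contra! h
  refine hx ?_
  induction hm using AddSubgroup.closure_induction with
  | mem m hm =>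
    obtain ⟨a, ha, b, hb, rfl⟩ := hm
    exact h a ha b hb
  | zero => simp
  | add a b _ _ ha hb =>
    by_cases h₁ : a * x = 0 <;> by_cases h₂ : b * x = 0 <;> simp_all [add_mul]
  | neg a _ ha =>
    by_cases h₁ : a * x = 0 <;> simp_all

end SGradedRing

/-- A strongly graded pseudo-unitary `S`-graded ring inducing `S` (with nonzero
components over `S \ {0}`) is graded von Neumann regular iff (a) every nonzero
homogeneous `x` admits a homogeneous `y` with `xy` a nonzero homogeneous element of
idempotent degree, and (b) every ring component is von Neumann regular. -/
theorem stmt14 (G : SGradedRing S R) (hpu : G.PseudoUnitary) (hst : G.StronglyGraded)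
    (hnz : ∀ s : S, s ≠ 0 → G.comp s ≠ ⊥) :
    G.GradedVNRegular ↔
      ((∀ x : R, G.IsHomog x → x ≠ 0 → ∃ y : R, G.IsHomog y ∧ x * y ≠ 0 ∧
          ∃ e : S, e * e = e ∧ x * y ∈ G.comp e) ∧
        ∀ e : S, e * e = e → ∀ x ∈ G.comp e, ∃ y ∈ G.comp e, x = x * y * x) := by
  obtain ⟨hc, u, hu, hunit⟩ := hpu
  constructor
  · intro hreg
    refine ⟨?_, ?_⟩
    · rintro x ⟨s, hs⟩ hx
      obtain ⟨r, hr⟩ := hreg x ⟨s, hs⟩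
      obtain ⟨t, y, hy, hxy, -⟩ := G.exists_homog_inner_inverse hc hs hx hr
      have hne : x * y ≠ 0 := fun h => hx (by rw [hxy, h, zero_mul])
      have hmem := G.mul_mem' hs hy
      have hmem' := G.mul_mem' hmem hmem
      rw [← mul_assoc, ← hxy] at hmem'
      exact ⟨y, ⟨t, hy⟩, hne, s * t, G.degree_unique_s14 hmem' hmem hne, hmem⟩
    · intro e he x hxe
      by_cases hx : x = 0
      · exact ⟨0, zero_mem _, by simp [hx]⟩
      obtain ⟨r, hr⟩ := hreg x ⟨e, hxe⟩
      obtain ⟨t, y, hy, hxy, h⟩ := G.exists_homog_inner_inverse hc hxe hx hr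
      have he0 := G.degree_ne_zero hxe hx
      have h₁ : e * t = e := hc.1 _ _ e (by rwa [h]) (h.trans he.symm)
      have h₂ : t = e := hc.2 _ _ e (by rwa [h₁]) (h₁.trans he.symm)
      exact ⟨y, h₂ ▸ hy, hxy⟩
  · rintro ⟨ha, hb⟩ x ⟨s, hs⟩
    by_cases hx : x = 0
    · exact ⟨0, by simp [hx]⟩
    obtain ⟨y, ⟨t, hy⟩, hxy, e, he, hxye⟩ := ha x ⟨s, hs⟩ hx
    have hst' : s * t = e := G.degree_unique_s14 (G.mul_mem' hs hy) hxye hxy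
    have he0 := G.degree_ne_zero hxye hxy
    have hs0 := G.degree_ne_zero hs hx
    obtain ⟨f, g, hf, hg, hfx, hxg⟩ := hunit x ⟨s, hs⟩
    have hfe : f = e := by
      have h := G.mul_mem' (hu f hf).1 hxye
      rw [← mul_assoc, hfx] at h
      have h' := G.degree_unique_s14 h hxye hxy
      exact hc.1 _ _ e (by rwa [h']) (h'.trans he.symm)
    subst hfe
    have hfs : f * s = s := by
      have h := G.mul_mem' (hu f hf).1 hs
      rw [hfx] at h
      exact G.degree_unique_s14 h hs hx
    have hsg : s * g = s := by
      have h := G.mul_mem' hs (hu g hg).1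
      rw [hxg] at h
      exact G.degree_unique_s14 h hs hx
    have hts : t * s = g := by
      have huf := (hu f hf).1
      rw [← hst', ← hst s t, hst'] at huf
      obtain ⟨a, has, b, hbt, hab⟩ :=
        SGradedRing.exists_mul_ne_zero_of_mem_subgroupMul huf (by rwa [hfx])
      have h₁ := G.mul_mem' (G.mul_mem' has hbt) hs
      have h₂ := G.mul_mem' has (G.mul_mem' hbt hs)
      rw [← mul_assoc] at h₂
      have h := G.degree_unique_s14 h₂ h₁ hab
      rw [hst', hfs] at h
      exact hc.2 _ _ s (by rwa [h]) (h.trans hsg.symm)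
    have hug := (hu g hg).1
    rw [← hts, ← hst t s, hts] at hug
    obtain ⟨w, -, hw, -⟩ := G.exists_extend_inner_inverse hf (hb f hf)
      (fun c hc => hst' ▸ G.mul_mem' hs hc) hug 0 (by simp)
    rw [hxg] at hw
    exact ⟨w, hw.symm⟩
end
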